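/- (Theorem 5: α-fair maximization under a throughput inequality constraint.) Let n ≥ 2 and α ≥ 1. (i) If θ ∈ (0, θ_n], then the maximum of F_α(x(p)) over p ∈ (0,1)^n with T(x(p)) ≥ θ is attained at the uniform control p* with all components equal to 1/n and equals −n·log(n/θ_n) if α = 1 and −(n/(α−1))·(n/θ_n)^{α−1} if α > 1; in particular this maximum does not depend on θ. (ii) If θ ∈ (θ_n, 1), then sup{ F_α(x(p)) : p ∈ (0,1)^n, T(x(p)) ≥ θ } = sup{ F_α(x(p)) : p ∈ (0,1)^n, T(x(p)) = θ }, so the solution coincides with that of the equality-constrained problem. -/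

import Mathlib

open scoped BigOperators

/-- The worst-case service rate of user `i` under control `p`. -/
noncomputable def rate {n : ℕ} (p : Fin n → ℝ) (i : Fin n) : ℝ :=
  p i * ∏ j ∈ Finset.univ.erase i, (1 - p j)

/-- The throughput of the rate vector of control `p`. -/
noncomputable def tput {n : ℕ} (p : Fin n → ℝ) : ℝ := ∑ i, rate p i

/-- The `α`-fair utility function. -/
noncomputable def Ualpha (α z : ℝ) : ℝ :=
  if α = 1 then Real.log z else z ^ (1 - α) / (1 - α)

/-- The `α`-fair objective (sum-user utility). -/
noncomputable def Falpha (α : ℝ) {n : ℕ} (x : Fin n → ℝ) : ℝ := ∑ i, Ualpha α (x i)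

/-- The critical throughput `θ_t = (1 - 1/t)^(t-1)`. -/
noncomputable def crit (t : ℕ) : ℝ := (1 - 1 / (t : ℝ)) ^ (t - 1)

theorem log_rate {n : ℕ} {p : Fin n → ℝ} (hp : ∀ i, p i ∈ Set.Ioo (0 : ℝ) 1) (i : Fin n) :
    Real.log (rate p i) = Real.log (p i) + ∑ j ∈ Finset.univ.erase i, Real.log (1 - p j) := by
  have h (j : Fin n) : 1 - p j ≠ 0 := (sub_pos.2 (hp j).2).ne'
  rw [rate, Real.log_mul (hp i).1.ne' (Finset.prod_ne_zero_iff.2 fun j _ => h j),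
    Real.log_prod fun j _ => h j]

theorem rate_pos {n : ℕ} {p : Fin n → ℝ} (hp : ∀ i, p i ∈ Set.Ioo (0 : ℝ) 1) (i : Fin n) :
    0 < rate p i :=
  mul_pos (hp i).1 (Finset.prod_pos fun j _ => sub_pos.2 (hp j).2)

/-- The utility `Ualpha α` is concave as a function of `log z` when `1 ≤ α`: it lies below its
tangent. -/
theorem Ualpha_le_tangent {α x y : ℝ} (hα : 1 ≤ α) (hx : 0 < x) (hy : 0 < y) :
    Ualpha α x ≤ Ualpha α y + y ^ (1 - α) * (Real.log x - Real.log y) := by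
  rcases hα.eq_or_lt with rfl | hα
  · simp [Ualpha]
  · have hs : 0 < α - 1 := by linarith
    have key : y ^ (1 - α) * (1 + (Real.log x - Real.log y) * (1 - α)) ≤ x ^ (1 - α) := by
      have h : x ^ (1 - α) =
          y ^ (1 - α) * Real.exp ((Real.log x - Real.log y) * (1 - α)) := by
        rw [Real.rpow_def_of_pos hx, Real.rpow_def_of_pos hy, ← Real.exp_add]
        ring_nf
      rw [h]
      gcongr
      linarith [Real.add_one_le_exp ((Real.log x - Real.log y) * (1 - α))]
    have hne : (1 : ℝ) - α ≠ 0 := by linarith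
    rw [Ualpha, Ualpha, if_neg hα.ne', if_neg hα.ne', div_le_iff_of_neg (by linarith), add_mul,
      div_mul_cancel₀ _ hne]
    linarith

theorem inv_natCast_mem_Ioo {n : ℕ} (hn : 2 ≤ n) : (1 : ℝ) / n ∈ Set.Ioo (0 : ℝ) 1 := by
  have h : (2 : ℝ) ≤ n := by exact_mod_cast hn
  exact ⟨by positivity, by rw [div_lt_one (by positivity)]; linarith⟩

theorem rate_uniform (n : ℕ) (i : Fin n) :
    rate (fun _ : Fin n => (1 : ℝ) / n) i = crit n / n := by
  simp [rate, crit, Finset.card_erase_of_mem]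
  ring

theorem tput_uniform {n : ℕ} (hn : 2 ≤ n) :
    tput (fun _ : Fin n => (1 : ℝ) / n) = crit n := by
  have h : (n : ℝ) ≠ 0 := by positivity
  simp only [tput, rate_uniform, Finset.sum_const, Finset.card_univ, Fintype.card_fin,
    nsmul_eq_mul]
  field_simp

theorem log_add_mul_log_one_sub_le {n : ℕ} (hn : 2 ≤ n) {x : ℝ} (hx : x ∈ Set.Ioo (0 : ℝ) 1) :
    Real.log x + (n - 1) * Real.log (1 - x) ≤
      Real.log (1 / n) + (n - 1) * Real.log (1 - 1 / n) := by
  have h2 : (2 : ℝ) ≤ n := by exact_mod_cast hn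
  have hu := inv_natCast_mem_Ioo hn
  have hv : (0 : ℝ) < 1 - 1 / n := sub_pos.2 hu.2
  have h1x : 0 < 1 - x := sub_pos.2 hx.2
  have ha := Real.log_le_sub_one_of_pos (div_pos hx.1 hu.1)
  have hb := mul_le_mul_of_nonneg_left (Real.log_le_sub_one_of_pos (div_pos h1x hv))
    (by linarith : (0 : ℝ) ≤ n - 1)
  rw [Real.log_div hx.1.ne' hu.1.ne'] at ha
  rw [Real.log_div h1x.ne' hv.ne'] at hb
  have hne : (n : ℝ) - 1 ≠ 0 := by linarith
  have e : (x / (1 / n) - 1) + (n - 1) * ((1 - x) / (1 - 1 / n) - 1) = 0 := by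
    have : (1 : ℝ) - 1 / n = (n - 1) / n := by field_simp
    rw [this]
    field_simp
    ring
  linarith

theorem sum_log_rate {n : ℕ} {p : Fin n → ℝ} (hp : ∀ i, p i ∈ Set.Ioo (0 : ℝ) 1) :
    ∑ i, Real.log (rate p i) = ∑ i, (Real.log (p i) + (n - 1) * Real.log (1 - p i)) := by
  simp only [log_rate hp, Finset.sum_erase_eq_sub (Finset.mem_univ _), Finset.sum_add_distrib,
    Finset.sum_sub_distrib, Finset.sum_const, Finset.card_univ, Fintype.card_fin, nsmul_eq_mul,
    ← Finset.mul_sum]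
  ring

/-- The uniform control globally maximizes the `α`-fair objective. -/
theorem Falpha_rate_le_uniform {n : ℕ} (hn : 2 ≤ n) {α : ℝ} (hα : 1 ≤ α) {p : Fin n → ℝ}
    (hp : ∀ i, p i ∈ Set.Ioo (0 : ℝ) 1) :
    Falpha α (fun i => rate p i) ≤
      Falpha α (fun i => rate (fun _ : Fin n => (1 : ℝ) / n) i) := by
  have hu : ∀ _ : Fin n, (1 : ℝ) / n ∈ Set.Ioo (0 : ℝ) 1 := fun _ => inv_natCast_mem_Ioo hn
  have hlog : ∑ i, Real.log (rate p i) ≤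
      ∑ i, Real.log (rate (fun _ : Fin n => (1 : ℝ) / n) i) := by
    rw [sum_log_rate hp, sum_log_rate hu]
    exact Finset.sum_le_sum fun i _ => log_add_mul_log_one_sub_le hn (hp i)
  have hc : 0 < crit n / n := by
    have := rate_pos hu ⟨0, by omega⟩
    rwa [rate_uniform] at this
  simp only [Falpha, rate_uniform] at hlog ⊢
  calc ∑ i, Ualpha α (rate p i)
      ≤ ∑ i, (Ualpha α (crit n / n) +
          (crit n / n) ^ (1 - α) * (Real.log (rate p i) - Real.log (crit n / n))) :=
        Finset.sum_le_sum fun i _ => Ualpha_le_tangent hα (rate_pos hp i) hc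
    _ = ∑ _i : Fin n, Ualpha α (crit n / n) + (crit n / n) ^ (1 - α) *
          (∑ i, Real.log (rate p i) - ∑ _i : Fin n, Real.log (crit n / n)) := by
        rw [Finset.sum_add_distrib, ← Finset.mul_sum, Finset.sum_sub_distrib]
    _ ≤ ∑ _i : Fin n, Ualpha α (crit n / n) := by
        have := mul_nonneg (Real.rpow_nonneg hc.le (1 - α)) (sub_nonneg.2 hlog)
        linarith

theorem concaveOn_log_rate {n : ℕ} (i : Fin n) :
    ConcaveOn ℝ (Set.univ.pi fun _ : Fin n => Set.Ioo (0 : ℝ) 1)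
      fun p => Real.log (rate p i) := by
  refine ⟨convex_pi fun _ _ => convex_Ioo 0 1, fun p hp q hq a b ha hb hab => ?_⟩
  have hpq := convex_pi (fun _ _ => convex_Ioo (0 : ℝ) 1) hp hq ha hb hab
  simp only [Set.mem_univ_pi] at hp hq hpq
  simp only [log_rate hp, log_rate hq, log_rate hpq, smul_add, Finset.smul_sum]
  rw [add_add_add_comm, ← Finset.sum_add_distrib]
  have hlog := strictConcaveOn_log_Ioi.concaveOn
  refine add_le_add (hlog.2 (hp i).1 (hq i).1 ha hb hab) (Finset.sum_le_sum fun j _ => ?_)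
  refine (hlog.2 (sub_pos.2 (hp j).2) (sub_pos.2 (hq j).2) ha hb hab).trans_eq ?_
  congr 1
  simp only [smul_eq_mul, Pi.add_apply, Pi.smul_apply]
  linear_combination hab

/-- The `α`-fair objective is a concave function of the control when `1 ≤ α`. -/
theorem concaveOn_Falpha_rate {n : ℕ} {α : ℝ} (hα : 1 ≤ α) :
    ConcaveOn ℝ (Set.univ.pi fun _ : Fin n => Set.Ioo (0 : ℝ) 1)
      fun p => Falpha α fun i => rate p i := by
  refine ⟨convex_pi fun _ _ => convex_Ioo 0 1, fun p hp q hq a b ha hb hab => ?_⟩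
  have hpq := convex_pi (fun _ _ => convex_Ioo (0 : ℝ) 1) hp hq ha hb hab
  simp only [Falpha, Finset.smul_sum]
  rw [← Finset.sum_add_distrib]
  refine Finset.sum_le_sum fun i _ => ?_
  have hlog := (concaveOn_log_rate i).2 hp hq ha hb hab
  simp only [Set.mem_univ_pi] at hp hq hpq
  have hz := rate_pos hpq i
  have h1 := mul_le_mul_of_nonneg_left (Ualpha_le_tangent hα (rate_pos hp i) hz) ha
  have h2 := mul_le_mul_of_nonneg_left (Ualpha_le_tangent hα (rate_pos hq i) hz) hb
  have h3 := mul_nonneg (Real.rpow_nonneg hz.le (1 - α)) (sub_nonneg.2 hlog)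
  simp only [smul_eq_mul] at h1 h2 h3 ⊢
  generalize rate (a • p + b • q) i = z at *
  obtain rfl : b = 1 - a := by linarith
  linarith

theorem continuous_tput {n : ℕ} : Continuous fun p : Fin n → ℝ => tput p := by
  unfold tput rate
  fun_prop

/-- Moving towards the uniform control lowers the throughput to any prescribed intermediate level
without decreasing the objective. -/
theorem exists_tput_eq_of_le {n : ℕ} (hn : 2 ≤ n) {α θ : ℝ} (hα : 1 ≤ α) (hθ : crit n ≤ θ)
    {p : Fin n → ℝ} (hp : ∀ i, p i ∈ Set.Ioo (0 : ℝ) 1) (hpθ : θ ≤ tput p) :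
    ∃ q : Fin n → ℝ, (∀ i, q i ∈ Set.Ioo (0 : ℝ) 1) ∧ tput q = θ ∧
      Falpha α (fun i => rate p i) ≤ Falpha α (fun i => rate q i) := by
  set u : Fin n → ℝ := fun _ => (1 : ℝ) / n
  have hu : ∀ i, u i ∈ Set.Ioo (0 : ℝ) 1 := fun _ => inv_natCast_mem_Ioo hn
  have hseg : IsPreconnected (segment ℝ u p) := (convex_segment u p).isPreconnected
  obtain ⟨q, hq, hqθ⟩ := hseg.intermediate_value (left_mem_segment ℝ u p)
    (right_mem_segment ℝ u p) continuous_tput.continuousOn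
    ⟨(tput_uniform hn).trans_le hθ, hpθ⟩
  have hu' := Set.mem_univ_pi.2 hu
  have hp' := Set.mem_univ_pi.2 hp
  have hconc := concaveOn_Falpha_rate (n := n) hα
  refine ⟨q, Set.mem_univ_pi.1 (hconc.1.segment_subset hu' hp' hq), hqθ, ?_⟩
  have hmin := hconc.min_le_of_mem_segment hu' hp' hq
  rwa [min_eq_right (Falpha_rate_le_uniform hn hα hp)] at hmin

theorem alpha_fair_inequality_constraint (n : ℕ) (hn : 2 ≤ n) (α : ℝ) (hα : 1 ≤ α)
    (θ : ℝ) :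
    -- (i) below the critical throughput: the uniform control 1/n is optimal and
    -- the optimal value does not depend on θ.
    (0 < θ → θ ≤ crit n →
      (θ ≤ tput (fun _ : Fin n => (1 : ℝ) / n) ∧
       (∀ p : Fin n → ℝ, (∀ i, p i ∈ Set.Ioo (0:ℝ) 1) → θ ≤ tput p →
         Falpha α (fun i => rate p i) ≤
           Falpha α (fun i => rate (fun _ : Fin n => (1 : ℝ) / n) i)) ∧
       (α = 1 →
         Falpha α (fun i => rate (fun _ : Fin n => (1 : ℝ) / n) i) =
           -(n : ℝ) * Real.log ((n : ℝ) / crit n)) ∧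
       (1 < α →
         Falpha α (fun i => rate (fun _ : Fin n => (1 : ℝ) / n) i) =
           -((n : ℝ) / (α - 1)) * ((n : ℝ) / crit n) ^ (α - 1)))) ∧
    -- (ii) above the critical throughput: the inequality- and equality-constrained
    -- problems have the same optimal value.
    (crit n < θ → θ < 1 →
      sSup {v : ℝ | ∃ p : Fin n → ℝ, (∀ i, p i ∈ Set.Ioo (0:ℝ) 1) ∧
          θ ≤ tput p ∧ v = Falpha α (fun i => rate p i)} =
      sSup {v : ℝ | ∃ p : Fin n → ℝ, (∀ i, p i ∈ Set.Ioo (0:ℝ) 1) ∧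
          tput p = θ ∧ v = Falpha α (fun i => rate p i)}) := by
  have hunif := tput_uniform hn
  have hc : 0 < crit n / n := by
    have := rate_pos (fun _ : Fin n => inv_natCast_mem_Ioo hn) ⟨0, by omega⟩
    rwa [rate_uniform] at this
  refine ⟨fun _ hθ => ⟨hθ.trans_eq hunif.symm,
    fun p hp _ => Falpha_rate_le_uniform hn hα hp, ?_, ?_⟩, fun hθ _ => ?_⟩
  · rintro rfl
    simp only [Falpha, rate_uniform, Ualpha, if_true, Finset.sum_const, Finset.card_univ,
      Fintype.card_fin, nsmul_eq_mul]
    rw [← inv_div, Real.log_inv]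
    ring
  · intro h1
    have hne : (1 : ℝ) - α ≠ 0 := by linarith
    have hne' : α - 1 ≠ 0 := by linarith
    simp only [Falpha, rate_uniform, Ualpha, if_neg h1.ne', Finset.sum_const, Finset.card_univ,
      Fintype.card_fin, nsmul_eq_mul]
    rw [← inv_div (crit n) (n : ℝ), Real.inv_rpow hc.le, ← Real.rpow_neg hc.le, neg_sub,
      ← neg_sub α 1, div_neg]
    ring
  · apply csSup_eq_csSup_of_forall_exists_le
    · rintro _ ⟨p, hp, hpθ, rfl⟩
      obtain ⟨q, hq, hqθ, hle⟩ := exists_tput_eq_of_le hn hα hθ.le hp hpθ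
      exact ⟨_, ⟨q, hq, hqθ, rfl⟩, hle⟩
    · rintro _ ⟨q, hq, hqθ, rfl⟩
      exact ⟨_, ⟨q, hq, hqθ.ge, rfl⟩, le_rfl⟩
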